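/- Let R be a commutative Noetherian ring and let (𝒯,ℱ) be a torsion pair in R-Mod. Then (𝒯,ℱ) is a tCG torsion pair if and only if (𝒯,ℱ) is a hereditary torsion pair. -/

import Mathlib

open CategoryTheory Limits DirectSum

universe w u

variable (R : Type u) [CommRing R]

/-- A torsion pair `(T, F)` in the category of left `R`-modules: both classes are closed
under isomorphism, all homomorphisms from `T` to `F` vanish, and every module has a
torsion submodule in `T` with torsion-free quotient in `F`. -/
structure ModTorsionPair (T F : ModuleCat.{u} R → Prop) : Prop where
  iso_closed_torsion : ∀ {M N : ModuleCat.{u} R}, (M ≅ N) → T M → T N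
  iso_closed_torsionfree : ∀ {M N : ModuleCat.{u} R}, (M ≅ N) → F M → F N
  hom_eq_zero : ∀ {M N : ModuleCat.{u} R}, T M → F N → ∀ f : M →ₗ[R] N, f = 0
  exists_torsion_submodule : ∀ M : ModuleCat.{u} R, ∃ t : Submodule R M,
    T (ModuleCat.of R t) ∧ F (ModuleCat.of R (M ⧸ t))

/-- The torsion pair `(T, F)` is tCG: there is a set of finitely presented modules in
the torsion class `T` whose simultaneous `Hom`-vanishing cuts out exactly the
torsion-free class `F`. -/
def IsTCGTorsionPair (T F : ModuleCat.{u} R → Prop) : Prop :=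
  ∃ (Λ : Type u) (Tfam : Λ → ModuleCat.{u} R),
    (∀ l, Module.FinitePresentation R (Tfam l)) ∧ (∀ l, T (Tfam l)) ∧
    ∀ M : ModuleCat.{u} R, F M ↔ ∀ (l : Λ) (f : Tfam l →ₗ[R] M), f = 0

/-- A class of modules is hereditary (closed under submodules). -/
def HereditaryClass (T : ModuleCat.{u} R → Prop) : Prop :=
  ∀ M : ModuleCat.{u} R, T M → ∀ N : Submodule R M, T (ModuleCat.of R N)

variable {R}

namespace ModTorsionPair

variable {T F : ModuleCat.{u} R → Prop}

theorem torsion_of_torsionfree_quotient_subsingleton (htp : ModTorsionPair R T F)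
    (M : ModuleCat.{u} R)
    (h : ∀ t : Submodule R M, F (ModuleCat.of R (M ⧸ t)) → Subsingleton (M ⧸ t)) : T M := by
  obtain ⟨t, hT, hF⟩ := htp.exists_torsion_submodule M
  have ht : t = ⊤ := Submodule.Quotient.subsingleton_iff.mp (h t hF)
  subst ht
  exact htp.iso_closed_torsion (LinearEquiv.toModuleIso Submodule.topEquiv) hT

theorem torsionfree_of_torsion_submodule_eq_bot (htp : ModTorsionPair R T F)
    (M : ModuleCat.{u} R)
    (h : ∀ t : Submodule R M, T (ModuleCat.of R t) → t = ⊥) : F M := by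
  obtain ⟨t, hT, hF⟩ := htp.exists_torsion_submodule M
  obtain rfl := h t hT
  exact htp.iso_closed_torsionfree (LinearEquiv.toModuleIso (Submodule.quotEquivOfEqBot _ rfl)) hF

theorem isTCG_of_hereditary [IsNoetherianRing R] (htp : ModTorsionPair R T F)
    (hT : HereditaryClass R T) : IsTCGTorsionPair R T F := by
  refine ⟨{I : Ideal R // T (ModuleCat.of R (R ⧸ I))}, fun I => ModuleCat.of R (R ⧸ I.1),
    fun I => Module.finitePresentation_of_finite R (R ⧸ I.1), fun I => I.2,
    fun M => ⟨fun hM I f => htp.hom_eq_zero I.2 hM f, fun hM => ?_⟩⟩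
  refine htp.torsionfree_of_torsion_submodule_eq_bot M fun t ht => ?_
  rw [eq_bot_iff]
  intro x hx
  let g : R →ₗ[R] t := LinearMap.toSpanSingleton R t ⟨x, hx⟩
  have hI : T (ModuleCat.of R (R ⧸ LinearMap.ker g)) :=
    htp.iso_closed_torsion (LinearEquiv.toModuleIso g.quotKerEquivRange.symm)
      (hT (ModuleCat.of R t) ht (LinearMap.range g))
  have h0 := hM ⟨LinearMap.ker g, hI⟩
    (t.subtype ∘ₗ (LinearMap.range g).subtype ∘ₗ g.quotKerEquivRange.toLinearMap)
  have h1 := LinearMap.congr_fun h0 (Submodule.Quotient.mk 1)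
  have h2 : ((g.quotKerEquivRange (Submodule.Quotient.mk 1) : LinearMap.range g) : t) = g 1 := rfl
  have h3 : ((g 1 : t) : M) = 0 := by rw [← h2]; exact h1
  simpa [g] using h3

end ModTorsionPair

theorem Ideal.isLocalizedModule_quotient_residueField (p : Ideal R) [p.IsPrime] :
    IsLocalizedModule p.primeCompl
      (IsScalarTower.toAlgHom R (R ⧸ p) p.ResidueField).toLinearMap := by
  rw [isLocalizedModule_iff_isLocalization]
  have h : Algebra.algebraMapSubmonoid (R ⧸ p) p.primeCompl = nonZeroDivisors (R ⧸ p) := by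
    ext x
    obtain ⟨x, rfl⟩ := Ideal.Quotient.mk_surjective x
    rw [mem_nonZeroDivisors_iff_ne_zero, Ne, Ideal.Quotient.eq_zero_iff_mem]
    constructor
    · rintro ⟨y, hy, hxy⟩ hx
      refine hy (Ideal.Quotient.eq_zero_iff_mem.mp (hxy.trans ?_))
      exact Ideal.Quotient.eq_zero_iff_mem.mpr hx
    · exact fun hx => ⟨x, hx, rfl⟩
  rw [h]
  infer_instance

theorem Module.FinitePresentation.exists_ne_zero_hom_quotient_of_mem_support
    {M : Type*} [AddCommGroup M] [Module R M] [Module.FinitePresentation R M]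
    {p : PrimeSpectrum R} (hp : p ∈ Module.support R M) :
    ∃ f : M →ₗ[R] R ⧸ p.asIdeal, f ≠ 0 := by
  have hnt := (Module.mem_support_iff_nontrivial_residueField_tensorProduct p).mp hp
  obtain ⟨v, hv⟩ := exists_ne (0 : TensorProduct R p.asIdeal.ResidueField M)
  obtain ⟨φ, hφ⟩ := Module.Projective.exists_dual_ne_zero p.asIdeal.ResidueField hv
  let g : M →ₗ[R] p.asIdeal.ResidueField :=
    φ.restrictScalars R ∘ₗ TensorProduct.mk R p.asIdeal.ResidueField M 1
  have hg : g ≠ 0 := by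
    intro h
    have : φ = 0 := by
      ext m
      exact LinearMap.congr_fun h m
    exact hφ (by simp [this])
  have := Ideal.isLocalizedModule_quotient_residueField p.asIdeal
  obtain ⟨f, s, hf⟩ := Module.FinitePresentation.exists_lift_of_isLocalizedModule
    p.asIdeal.primeCompl
    (IsScalarTower.toAlgHom R (R ⧸ p.asIdeal) p.asIdeal.ResidueField).toLinearMap g
  refine ⟨f, ?_⟩
  rintro rfl
  refine hg (LinearMap.ext fun m => ?_)
  apply ((Module.End.isUnit_iff _).mp (IsLocalizedModule.map_units
    (IsScalarTower.toAlgHom R (R ⧸ p.asIdeal) p.asIdeal.ResidueField).toLinearMap s)).injective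
  simpa [Submonoid.smul_def] using (LinearMap.congr_fun hf m).symm

/-- A module all of whose elements are killed by elements outside `p` has no nonzero map to a
localization at `p`. -/
theorem LinearMap.eq_zero_of_notMem_support {M N : Type*} [AddCommGroup M] [Module R M]
    [AddCommGroup N] [Module R N] {p : PrimeSpectrum R} (hp : p ∉ Module.support R M)
    (f : M →ₗ[R] LocalizedModule p.asIdeal.primeCompl N) : f = 0 := by
  ext m
  obtain ⟨r, hr, hm⟩ := Module.notMem_support_iff'.mp hp m
  have h := (Module.End.isUnit_iff _).mp (IsLocalizedModule.map_units
    (LocalizedModule.mkLinearMap p.asIdeal.primeCompl N)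
    (⟨r, hr⟩ : p.asIdeal.primeCompl))
  apply h.injective
  simp [← map_smul, hm]

theorem IsAssociatedPrime.exists_injective_quotient [IsNoetherianRing R]
    {M : Type*} [AddCommGroup M] [Module R M] {p : Ideal R} (hp : IsAssociatedPrime p M) :
    ∃ f : (R ⧸ p) →ₗ[R] M, Function.Injective f := by
  obtain ⟨-, x, hx⟩ := isAssociatedPrime_iff.mp hp
  have hk : p = LinearMap.ker (LinearMap.toSpanSingleton R M x) := by
    rw [hx]
    ext r
    simp [Submodule.mem_colon_singleton]
  refine ⟨p.liftQ (LinearMap.toSpanSingleton R M x) hk.le, ?_⟩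
  rw [← LinearMap.ker_eq_bot]
  exact Submodule.ker_liftQ_eq_bot' _ _ hk

namespace ModTorsionPair

variable {T F : ModuleCat.{u} R → Prop}

theorem hereditary_of_isTCG [IsNoetherianRing R] (htp : ModTorsionPair R T F)
    (h : IsTCGTorsionPair R T F) : HereditaryClass R T := by
  obtain ⟨Λ, S, hfp, hS, hF⟩ := h
  have hsupp : ∀ M : ModuleCat.{u} R, T M → ∀ p ∈ Module.support R M,
      ∃ l, p ∈ Module.support R (S l) := by
    intro M hM p hp
    by_contra! hcon
    have hloc : F (ModuleCat.of R (LocalizedModule p.asIdeal.primeCompl M)) :=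
      (hF _).mpr fun l f => LinearMap.eq_zero_of_notMem_support (hcon l) f
    have h0 := htp.hom_eq_zero hM hloc (LocalizedModule.mkLinearMap p.asIdeal.primeCompl M)
    refine Module.notMem_support_iff'.mpr (fun m => ?_) hp
    have hm := LinearMap.congr_fun h0 m
    obtain ⟨s, hs⟩ := (IsLocalizedModule.eq_zero_iff p.asIdeal.primeCompl _).mp hm
    exact ⟨s, s.2, hs⟩
  intro M hM N
  refine htp.torsion_of_torsionfree_quotient_subsingleton _ fun t ht => ?_
  by_contra hnt
  rw [not_subsingleton_iff_nontrivial] at hnt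
  obtain ⟨p, hp⟩ := associatedPrimes.nonempty R (N ⧸ t)
  obtain ⟨g, hg⟩ := IsAssociatedPrime.exists_injective_quotient hp
  have hprime : p.IsPrime := IsAssociatedPrime.isPrime hp
  have hpM : (⟨p, hprime⟩ : PrimeSpectrum R) ∈ Module.support R M := by
    refine Module.support_subset_of_injective N.subtype N.injective_subtype
      (Module.support_subset_of_surjective t.mkQ t.mkQ_surjective
        (Module.support_subset_of_injective g hg ?_))
    rw [Module.support_eq_zeroLocus, Ideal.annihilator_quotient]
    exact le_refl p
  obtain ⟨l, hl⟩ := hsupp M hM _ hpM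
  have := hfp l
  obtain ⟨f, hf⟩ := Module.FinitePresentation.exists_ne_zero_hom_quotient_of_mem_support hl
  refine hf (LinearMap.ext fun x => hg ?_)
  simpa using LinearMap.congr_fun ((hF _).mp ht l (g ∘ₗ f)) x

end ModTorsionPair

variable (R)

/-- **Theorem.** Over a commutative Noetherian ring, a torsion pair is tCG if and only
if it is hereditary. -/
theorem comm_noetherian_tCG_iff_hereditary [IsNoetherianRing R]
    (T F : ModuleCat.{u} R → Prop) (htp : ModTorsionPair R T F) :
    IsTCGTorsionPair R T F ↔ HereditaryClass R T := by
  exact ⟨htp.hereditary_of_isTCG, htp.isTCG_of_hereditary⟩
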